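/- Let N, T, r be positive integers, X a real T×N matrix, λ ≥ 0, D = I_N + λ Π_N, and L the PPCA objective L(B,F) = (TN)⁻¹‖X − FBᵀ‖_F² + (λ/N) Tr(Bᵀ Π_N B). For any F ∈ ℝ^{T×r} with FᵀF = T·I_r, the profiled objective value at B̂ = T⁻¹ D⁻¹ Xᵀ F equals L(B̂,F) = (NT)⁻¹ Tr(XᵀX) − (NT²)⁻¹ Tr(Fᵀ X D⁻¹ Xᵀ F). -/

import Mathlib

open Matrix BigOperators

/-- The normalized Laplacian matrix `Π_N = I_N − (1/N) J_N`. -/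
noncomputable def PiN (N : ℕ) : Matrix (Fin N) (Fin N) ℝ :=
  1 - (N : ℝ)⁻¹ • Matrix.of (fun _ _ => (1 : ℝ))

/-- The matrix `D = I_N + λ Π_N`. -/
noncomputable def Dmat (N : ℕ) (lam : ℝ) : Matrix (Fin N) (Fin N) ℝ :=
  1 + lam • PiN N

/-- The PPCA objective `L(B,F) = (TN)⁻¹‖X − FBᵀ‖_F² + (λ/N) Tr(Bᵀ Π_N B)`. -/
noncomputable def Lobj (N T r : ℕ) (lam : ℝ) (X : Matrix (Fin T) (Fin N) ℝ)
    (B : Matrix (Fin N) (Fin r) ℝ) (F : Matrix (Fin T) (Fin r) ℝ) : ℝ :=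
  ((T : ℝ) * (N : ℝ))⁻¹ * Matrix.trace ((X - F * Bᵀ)ᵀ * (X - F * Bᵀ))
    + (lam / (N : ℝ)) * Matrix.trace (Bᵀ * PiN N * B)

lemma PiN_transpose (N : ℕ) : (PiN N)ᵀ = PiN N := by
  have h : (Matrix.of fun _ _ => (1 : ℝ) : Matrix (Fin N) (Fin N) ℝ)ᵀ =
      Matrix.of fun _ _ => (1 : ℝ) := rfl
  rw [PiN, transpose_sub, transpose_one, transpose_smul, h]

lemma PiN_mul_self (N : ℕ) : PiN N * PiN N = PiN N := by
  have h : (Matrix.of fun _ _ => (1 : ℝ) : Matrix (Fin N) (Fin N) ℝ) *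
      Matrix.of (fun _ _ => (1 : ℝ)) = (N : ℝ) • Matrix.of fun _ _ => (1 : ℝ) := by
    ext i j
    simp [Matrix.mul_apply]
  rcases eq_or_ne (N : ℝ) 0 with hN | hN
  · simp [PiN, hN]
  · simp only [PiN, mul_sub, sub_mul, one_mul, mul_one, smul_mul_assoc, mul_smul_comm, h,
      inv_smul_smul₀ hN, sub_self, smul_zero, sub_zero]

lemma posSemidef_PiN (N : ℕ) : (PiN N).PosSemidef := by
  have h := posSemidef_conjTranspose_mul_self (PiN N)
  rwa [conjTranspose_eq_transpose_of_trivial, PiN_transpose, PiN_mul_self] at h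

lemma posDef_Dmat (N : ℕ) {lam : ℝ} (hlam : 0 ≤ lam) : (Dmat N lam).PosDef :=
  PosDef.one.add_posSemidef ((posSemidef_PiN N).smul hlam)

lemma Dmat_transpose (N : ℕ) (lam : ℝ) : (Dmat N lam)ᵀ = Dmat N lam := by
  rw [Dmat, transpose_add, transpose_one, transpose_smul, PiN_transpose]

/-- Expansion of the squared residual when the factors are normalized by `FᵀF = c • 1`. -/
lemma trace_residual_of_transpose_mul_self {m n k : Type*} [Fintype m] [Fintype n] [Fintype k]
    [DecidableEq k] (X : Matrix m n ℝ) (B : Matrix n k ℝ) (F : Matrix m k ℝ) {c : ℝ}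
    (hF : Fᵀ * F = c • (1 : Matrix k k ℝ)) :
    trace ((X - F * Bᵀ)ᵀ * (X - F * Bᵀ)) =
      trace (Xᵀ * X) - 2 * trace (Bᵀ * (Xᵀ * F)) + c * trace (Bᵀ * B) := by
  have h₁ : trace (Xᵀ * (F * Bᵀ)) = trace (Bᵀ * (Xᵀ * F)) := by
    rw [← Matrix.mul_assoc, trace_mul_comm]
  have h₂ : trace ((F * Bᵀ)ᵀ * X) = trace (Bᵀ * (Xᵀ * F)) := by
    rw [← h₁, ← trace_transpose, transpose_mul, transpose_transpose]
  have h₃ : trace ((F * Bᵀ)ᵀ * (F * Bᵀ)) = c * trace (Bᵀ * B) := by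
    rw [transpose_mul, transpose_transpose, Matrix.mul_assoc, ← Matrix.mul_assoc Fᵀ, hF,
      Matrix.smul_mul, Matrix.one_mul, Matrix.mul_smul, trace_smul, smul_eq_mul, trace_mul_comm]
  rw [transpose_sub, Matrix.sub_mul, Matrix.mul_sub, Matrix.mul_sub, trace_sub, trace_sub,
    trace_sub, h₁, h₂, h₃]
  ring

/-- For `F` with `FᵀF = T·I_r`, the profiled PPCA objective at
`B̂ = T⁻¹ D⁻¹ XᵀF` equals `L(B̂,F) = (NT)⁻¹Tr(XᵀX) − (NT²)⁻¹Tr(Fᵀ X D⁻¹ Xᵀ F)`. -/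
theorem ppca_profiled_objective (N T r : ℕ) (hN : 0 < N) (hT : 0 < T) (hr : 0 < r)
    (X : Matrix (Fin T) (Fin N) ℝ) (lam : ℝ) (hlam : 0 ≤ lam)
    (F : Matrix (Fin T) (Fin r) ℝ) (hF : Fᵀ * F = (T : ℝ) • (1 : Matrix (Fin r) (Fin r) ℝ))
    (Bhat : Matrix (Fin N) (Fin r) ℝ)
    (hBhat : Bhat = (T : ℝ)⁻¹ • ((Dmat N lam)⁻¹ * Xᵀ * F)) :
    Lobj N T r lam X Bhat F =
      ((N : ℝ) * (T : ℝ))⁻¹ * Matrix.trace (Xᵀ * X)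
        - ((N : ℝ) * (T : ℝ) ^ 2)⁻¹ * Matrix.trace (Fᵀ * X * (Dmat N lam)⁻¹ * Xᵀ * F) := by
  have hT' : (T : ℝ) ≠ 0 := by positivity
  have hN' : (N : ℝ) ≠ 0 := by positivity
  have hdet : IsUnit (Dmat N lam).det := (posDef_Dmat N hlam).det_pos.ne'.isUnit
  have hDB : Dmat N lam * Bhat = (T : ℝ)⁻¹ • (Xᵀ * F) := by
    rw [hBhat, Matrix.mul_smul, Matrix.mul_assoc, mul_nonsing_inv_cancel_left _ _ hdet]
  have hquad : trace (Bhatᵀ * Bhat) + lam * trace (Bhatᵀ * PiN N * Bhat) =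
      (T : ℝ)⁻¹ * trace (Bhatᵀ * (Xᵀ * F)) := by
    rw [← smul_eq_mul (T : ℝ)⁻¹, ← trace_smul, ← Matrix.mul_smul, ← hDB, Dmat, Matrix.add_mul,
      Matrix.one_mul, Matrix.mul_add, trace_add, Matrix.smul_mul, Matrix.mul_smul, trace_smul,
      smul_eq_mul, Matrix.mul_assoc]
  have hcross : trace (Bhatᵀ * (Xᵀ * F)) =
      (T : ℝ)⁻¹ * trace (Fᵀ * X * (Dmat N lam)⁻¹ * Xᵀ * F) := by
    rw [hBhat, transpose_smul, transpose_mul, transpose_mul, transpose_transpose,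
      transpose_nonsing_inv, Dmat_transpose, Matrix.smul_mul, trace_smul, smul_eq_mul]
    simp only [Matrix.mul_assoc]
  rw [Lobj, trace_residual_of_transpose_mul_self X Bhat F hF, eq_sub_of_add_eq hquad, hcross]
  field_simp
  ring
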